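/- Let Ω ⊂ ℝⁿ be a bounded, open, connected set with smooth boundary and let u ∈ C³(Ω) ∩ C¹(cl Ω) satisfy u = 0 on ∂Ω (with all the integrals below finite). Then 2 ∫_Ω u S₂(D²u) dx = ∫_Ω ( ⟨D²u ∇u, ∇u⟩ − Δu ‖∇u‖² ) dx, where S₂(D²u) = ((Δu)² − Tr((D²u)²))/2. -/

import Mathlib

open MeasureTheory Set
open scoped Topology

noncomputable section

/-- The `i`-th standard basis vector of `EuclideanSpace ℝ (Fin n)`. -/
def stdVec (n : ℕ) (i : Fin n) : EuclideanSpace ℝ (Fin n) := EuclideanSpace.single i 1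

/-- The second partial derivative `∂²u/∂xᵢ∂xⱼ`. -/
noncomputable def secondDeriv (n : ℕ) (u : EuclideanSpace ℝ (Fin n) → ℝ) (i j : Fin n)
    (x : EuclideanSpace ℝ (Fin n)) : ℝ :=
  fderiv ℝ (fun y => fderiv ℝ u y (stdVec n j)) x (stdVec n i)

/-- The Euclidean Laplacian `Δu = ∑ i, ∂²u/∂xᵢ²`. -/
noncomputable def lap (n : ℕ) (u : EuclideanSpace ℝ (Fin n) → ℝ)
    (x : EuclideanSpace ℝ (Fin n)) : ℝ :=
  ∑ i, secondDeriv n u i i x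

/-- `Ω` has `C^k` boundary: near every boundary point, `Ω` is the sublevel set of a
`C^k` local defining function with nonvanishing gradient. -/
def HasCkBoundary {n : ℕ} (k : ℕ∞) (Ω : Set (EuclideanSpace ℝ (Fin n))) : Prop :=
  ∀ x ∈ frontier Ω, ∃ (U : Set (EuclideanSpace ℝ (Fin n))) (f : EuclideanSpace ℝ (Fin n) → ℝ),
    IsOpen U ∧ x ∈ U ∧ ContDiffOn ℝ k f U ∧ (∀ y ∈ U, gradient f y ≠ 0) ∧
    Ω ∩ U = {y ∈ U | f y < 0} ∧ frontier Ω ∩ U = {y ∈ U | f y = 0}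

/-- `ν` is the outward unit normal vector field on the boundary of `Ω`. -/
def IsOutwardUnitNormal {n : ℕ} (Ω : Set (EuclideanSpace ℝ (Fin n)))
    (ν : EuclideanSpace ℝ (Fin n) → EuclideanSpace ℝ (Fin n)) : Prop :=
  ∀ x ∈ frontier Ω, ‖ν x‖ = 1 ∧ ∃ ε > 0, ∀ t : ℝ, 0 < t → t < ε →
    x + t • ν x ∉ closure Ω ∧ x - t • ν x ∈ Ω

section
variable {E : Type*} [NormedAddCommGroup E] [NormedSpace ℝ E] [FiniteDimensional ℝ E]
  [MeasurableSpace E] [BorelSpace E] {μ : Measure E} [μ.IsAddHaarMeasure]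

/-- The regular points of a level set of a differentiable function form a null set. -/
theorem measure_zero_set_fderiv_ne_zero {f : E → ℝ} {s : Set E}
    (hf : ∀ x ∈ s, DifferentiableAt ℝ f x) :
    μ {x ∈ s | f x = 0 ∧ fderiv ℝ f x ≠ 0} = 0 := by
  set t := {x ∈ s | f x = 0 ∧ fderiv ℝ f x ≠ 0}
  have hv : ∀ x : E, ∃ v : E, x ∈ t → fderiv ℝ f x v = 1 := by
    intro x
    by_cases hx : x ∈ t
    · obtain ⟨w, hw⟩ := DFunLike.ne_iff.1 hx.2.2
      refine ⟨(fderiv ℝ f x w)⁻¹ • w, fun _ => ?_⟩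
      simpa using inv_mul_cancel₀ hw
    · exact ⟨0, fun h => absurd h hx⟩
  choose v hv using hv
  have h := addHaar_image_eq_zero_of_det_fderivWithin_eq_zero μ (f := id) (s := t)
    (f' := fun x => ContinuousLinearMap.id ℝ E - (fderiv ℝ f x).smulRight (v x)) ?_ ?_
  · simpa using h
  · intro x hx
    have h1 := ((hasFDerivAt_id (𝕜 := ℝ) x).sub
      ((hf x hx.1).hasFDerivAt.smul_const (v x))).hasFDerivWithinAt (s := t)
    refine h1.congr (fun y hy => ?_) ?_
    · simp [hy.2.1]
    · simp [hx.2.1]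
  · intro x hx
    by_contra hdet
    have hk := LinearMap.ker_eq_bot.2 ((LinearMap.equivOfDetNeZero _ hdet).injective)
    have hvk : v x ∈ (⊥ : Submodule ℝ E) := by
      rw [← hk]
      simp [LinearMap.equivOfDetNeZero, hv x hx]
    have := hv x hx
    rw [(Submodule.mem_bot ℝ).1 hvk] at this
    simp at this

/-- A `C¹` function on an open set that vanishes off a compact subset has directional derivatives
of vanishing integral. -/
theorem integrableOn_fderiv_and_setIntegral_eq_zero {Ω K : Set E} (hΩ : IsOpen Ω)
    (hK : IsCompact K) (hKΩ : K ⊆ Ω) {w : E → ℝ} (hw : ContDiffOn ℝ 1 w Ω)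
    (hw0 : ∀ x ∈ Ω, x ∉ K → w x = 0) (v : E) :
    IntegrableOn (fun x => fderiv ℝ w x v) Ω μ ∧ ∫ x in Ω, fderiv ℝ w x v ∂μ = 0 := by
  set g : E → ℝ := Ω.indicator w
  have hgK : ∀ x ∉ K, g x = 0 := by
    intro x hx
    by_cases hxΩ : x ∈ Ω
    · simp [g, hxΩ, hw0 x hxΩ hx]
    · simp [g, hxΩ]
  have hgw : ∀ x ∈ Ω, g =ᶠ[𝓝 x] w := fun x hx =>
    Filter.eventuallyEq_of_mem (hΩ.mem_nhds hx) fun y hy => indicator_of_mem hy w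
  have hg : ContDiff ℝ 1 g := by
    rw [contDiff_iff_contDiffAt]
    intro x
    by_cases hx : x ∈ Ω
    · exact (hw.contDiffAt (hΩ.mem_nhds hx)).congr_of_eventuallyEq (hgw x hx)
    · exact (contDiffAt_const (c := (0 : ℝ))).congr_of_eventuallyEq <|
        Filter.eventuallyEq_of_mem (hK.isClosed.isOpen_compl.mem_nhds fun h => hx (hKΩ h)) hgK
  have hgc : HasCompactSupport g := HasCompactSupport.intro hK hgK
  have hdc : Continuous fun x => fderiv ℝ g x v :=
    (hg.continuous_fderiv one_ne_zero).clm_apply continuous_const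
  have hdi : Integrable (fun x => fderiv ℝ g x v) μ :=
    hdc.integrable_of_hasCompactSupport (hgc.fderiv_apply ℝ v)
  have hd0 : ∫ x, fderiv ℝ g x v ∂μ = 0 := by
    have := integral_mul_fderiv_eq_neg_fderiv_mul_of_integrable (μ := μ) (f := fun _ => (1 : ℝ))
      (g := g) (v := v) (by simp) (by simpa using hdi)
      (by simpa using hg.continuous.integrable_of_hasCompactSupport hgc) (by simp)
      (fun x _ => hg.differentiable one_ne_zero x)
    simpa using this
  have heq : ∀ x ∈ Ω, fderiv ℝ g x v = fderiv ℝ w x v := fun x hx => by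
    rw [(hgw x hx).fderiv_eq]
  refine ⟨(hdi.integrableOn (s := Ω)).congr_fun heq hΩ.measurableSet, ?_⟩
  rw [← setIntegral_congr_fun hΩ.measurableSet heq, setIntegral_eq_integral_of_forall_compl_eq_zero,
    hd0]
  intro x hx
  have hx' : x ∉ tsupport g := fun h =>
    hx (hKΩ (closure_minimal (fun y hy => by_contra fun h =>
      Function.mem_support.1 hy (hgK y h)) hK.isClosed h))
  rw [image_eq_zero_of_notMem_tsupport fun h => hx' (tsupport_fderiv_subset ℝ h)]
  rfl
end

/-- Smooth truncations of the identity near the origin. -/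
theorem exists_contDiff_truncation :
    ∃ (φ : ℕ → ℝ → ℝ) (C : ℝ), (∀ k, ContDiff ℝ 1 (φ k)) ∧ (∀ k t, |φ k t| ≤ |t|) ∧
      (∀ k t, |deriv (φ k) t| ≤ C) ∧ (∀ k, ∃ ε > 0, ∀ t, |t| < ε → φ k t = 0) ∧
      (∀ t ≠ 0, ∀ᶠ k in Filter.atTop, φ k t = t ∧ deriv (φ k) t = 1) := by
  set ψ : ℝ → ℝ := fun t => t * Real.smoothTransition (t ^ 2 - 1) with hψ
  have hψd : ContDiff ℝ 1 ψ :=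
    contDiff_id.mul (Real.smoothTransition.contDiff.comp ((contDiff_id.pow 2).sub contDiff_const))
  have hlarge : ∀ t, 2 ≤ |t| → ψ t = t := by
    intro t ht
    have : 1 ≤ t ^ 2 - 1 := by rw [← sq_abs]; nlinarith
    simp [hψ, Real.smoothTransition.one_of_one_le this]
  have hderiv : ∀ t, 2 < |t| → deriv ψ t = 1 := by
    intro t ht
    have : ψ =ᶠ[𝓝 t] id := Filter.eventuallyEq_of_mem
      ((isOpen_lt continuous_const continuous_abs).mem_nhds ht) fun s hs => hlarge s (le_of_lt hs)
    rw [this.deriv_eq, deriv_id]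
  obtain ⟨C, hC⟩ : ∃ C, ∀ t, ‖deriv ψ t - 1‖ ≤ C := by
    refine ((hψd.continuous_deriv le_rfl).sub continuous_const).bounded_above_of_compact_support
      (HasCompactSupport.intro (isCompact_closedBall (0 : ℝ) 2) fun t ht => ?_)
    simp [hderiv t (by simpa using ht)]
  have hdk : ∀ (k : ℕ) (t : ℝ),
      deriv (fun t => ((k : ℝ) + 1)⁻¹ * ψ (((k : ℝ) + 1) * t)) t = deriv ψ (((k : ℝ) + 1) * t) := by
    intro k t
    have hk : (k : ℝ) + 1 ≠ 0 := by positivity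
    have h1 := ((hψd.differentiable one_ne_zero (((k : ℝ) + 1) * t)).hasDerivAt.comp t
      ((hasDerivAt_id t).const_mul ((k : ℝ) + 1))).const_mul ((k : ℝ) + 1)⁻¹
    refine h1.deriv.trans ?_
    field_simp
  refine ⟨fun k t => ((k : ℝ) + 1)⁻¹ * ψ (((k : ℝ) + 1) * t), C + 1, fun k => ?_, fun k t => ?_,
    fun k t => ?_, fun k => ?_, fun t ht => ?_⟩
  · exact contDiff_const.mul (hψd.comp (contDiff_const.mul contDiff_id))
  · have hk : (k : ℝ) + 1 ≠ 0 := by positivity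
    have h1 : ((k : ℝ) + 1)⁻¹ * ψ (((k : ℝ) + 1) * t) =
        t * Real.smoothTransition ((((k : ℝ) + 1) * t) ^ 2 - 1) := by
      simp only [hψ]; field_simp
    dsimp only
    rw [h1, abs_mul, abs_of_nonneg (Real.smoothTransition.nonneg _)]
    exact mul_le_of_le_one_right (abs_nonneg t) (Real.smoothTransition.le_one _)
  · rw [hdk]
    have := hC (((k : ℝ) + 1) * t)
    rw [Real.norm_eq_abs] at this
    grind
  · refine ⟨((k : ℝ) + 1)⁻¹, by positivity, fun t ht => ?_⟩
    have hk : (0 : ℝ) < (k : ℝ) + 1 := by positivity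
    have h1 : |((k : ℝ) + 1) * t| < 1 := by
      rw [abs_mul, abs_of_pos hk]
      calc ((k : ℝ) + 1) * |t| < ((k : ℝ) + 1) * ((k : ℝ) + 1)⁻¹ := by gcongr
        _ = 1 := mul_inv_cancel₀ hk.ne'
    have h2 : (((k : ℝ) + 1) * t) ^ 2 - 1 ≤ 0 := by
      rw [← sq_abs]; nlinarith [abs_nonneg (((k : ℝ) + 1) * t)]
    simp [hψ, Real.smoothTransition.zero_of_nonpos h2]
  · obtain ⟨N, hN⟩ := exists_nat_gt (2 / |t|)
    filter_upwards [Filter.eventually_ge_atTop N] with k hk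
    have hk' : (N : ℝ) ≤ k := by exact_mod_cast hk
    have hkp : (0 : ℝ) < (k : ℝ) + 1 := by positivity
    have hlt : 2 < |((k : ℝ) + 1) * t| := by
      rw [abs_mul, abs_of_pos hkp, ← div_lt_iff₀ (abs_pos.2 ht)]
      linarith
    exact ⟨by rw [hlarge _ hlt.le, inv_mul_cancel_left₀ hkp.ne'], by rw [hdk, hderiv _ hlt]⟩

section
variable {n : ℕ} {Ω : Set (EuclideanSpace ℝ (Fin n))} {u : EuclideanSpace ℝ (Fin n) → ℝ}

theorem gradient_apply_eq_fderiv (u : EuclideanSpace ℝ (Fin n) → ℝ)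
    (x : EuclideanSpace ℝ (Fin n)) (i : Fin n) :
    gradient u x i = fderiv ℝ u x (stdVec n i) := by
  rw [← inner_gradient_left, stdVec, EuclideanSpace.inner_single_right]
  simp

theorem contDiffOn_fderiv_stdVec {m k : WithTop ℕ∞} (hΩ : IsOpen Ω) (hu : ContDiffOn ℝ k u Ω)
    (hmk : m + 1 ≤ k) (i : Fin n) : ContDiffOn ℝ m (fun x => fderiv ℝ u x (stdVec n i)) Ω :=
  (hu.fderiv_of_isOpen hΩ hmk).clm_apply contDiffOn_const

theorem secondDeriv_comm (hΩ : IsOpen Ω) (hu : ContDiffOn ℝ 2 u Ω)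
    {x : EuclideanSpace ℝ (Fin n)} (hx : x ∈ Ω) (i j : Fin n) :
    secondDeriv n u i j x = secondDeriv n u j i x := by
  have hux := hu.contDiffAt (hΩ.mem_nhds hx)
  have hd : DifferentiableAt ℝ (fderiv ℝ u) x :=
    (hux.fderiv_right (m := 1) (by norm_num)).differentiableAt one_ne_zero
  have h : ∀ i j, secondDeriv n u i j x = fderiv ℝ (fderiv ℝ u) x (stdVec n i) (stdVec n j) := by
    intro i j
    rw [secondDeriv, fderiv_clm_apply hd (differentiableAt_const _)]
    simp
  rw [h, h]
  exact (hux.isSymmSndFDerivAt (by simp)).eq _ _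

theorem fderiv_secondDeriv_comm (hΩ : IsOpen Ω) (hu : ContDiffOn ℝ 3 u Ω)
    {x : EuclideanSpace ℝ (Fin n)} (hx : x ∈ Ω) (i j k : Fin n) :
    fderiv ℝ (secondDeriv n u i j) x (stdVec n k) =
      fderiv ℝ (secondDeriv n u k j) x (stdVec n i) :=
  secondDeriv_comm hΩ (contDiffOn_fderiv_stdVec hΩ hu (by norm_num) j) hx k i

/-- The divergence of `φ(u) ((Δu) ∇u - (D²u) ∇u)`. -/
theorem sum_fderiv_comp_mul_hessianField (hΩ : IsOpen Ω) (hu : ContDiffOn ℝ 3 u Ω)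
    {φ : ℝ → ℝ} (hφ : ContDiff ℝ 1 φ) {x : EuclideanSpace ℝ (Fin n)} (hx : x ∈ Ω) :
    ∑ i, fderiv ℝ (fun y => φ (u y) * ∑ j, (secondDeriv n u j j y * fderiv ℝ u y (stdVec n i)
        - secondDeriv n u i j y * fderiv ℝ u y (stdVec n j))) x (stdVec n i) =
      φ (u x) * ((lap n u x) ^ 2 - ∑ i, ∑ j, secondDeriv n u i j x * secondDeriv n u j i x)
      + deriv φ (u x) * (lap n u x * ‖gradient u x‖ ^ 2 -
        ∑ i, ∑ j, secondDeriv n u i j x * gradient u x i * gradient u x j) := by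
  have hΩx := hΩ.mem_nhds hx
  have hu2 : ContDiffOn ℝ 2 u Ω := hu.of_le (by norm_num)
  have hp2 : ∀ i, ContDiffOn ℝ 2 (fun x => fderiv ℝ u x (stdVec n i)) Ω :=
    contDiffOn_fderiv_stdVec hΩ hu (by norm_num)
  have hu' : HasFDerivAt u (fderiv ℝ u x) x :=
    ((hu.contDiffAt hΩx).differentiableAt (by norm_num)).hasFDerivAt
  have hp' : ∀ i, HasFDerivAt (fun y => fderiv ℝ u y (stdVec n i))
      (fderiv ℝ (fun y => fderiv ℝ u y (stdVec n i)) x) x := fun i =>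
    (((hp2 i).contDiffAt hΩx).differentiableAt (by norm_num)).hasFDerivAt
  have hH' : ∀ i j, HasFDerivAt (secondDeriv n u i j) (fderiv ℝ (secondDeriv n u i j) x) x :=
    fun i j => (((contDiffOn_fderiv_stdVec (m := 1) hΩ (hp2 j) (by norm_num) i).contDiffAt
      hΩx).differentiableAt one_ne_zero).hasFDerivAt
  have hthird : ∀ i j, fderiv ℝ (secondDeriv n u j i) x (stdVec n j) =
      fderiv ℝ (secondDeriv n u j j) x (stdVec n i) := by
    intro i j
    have : secondDeriv n u j i =ᶠ[𝓝 x] secondDeriv n u i j :=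
      Filter.eventuallyEq_of_mem hΩx fun y hy => secondDeriv_comm hΩ hu2 hy j i
    rw [this.fderiv_eq, fderiv_secondDeriv_comm hΩ hu hx]
  have hφ' := ((hφ.differentiable one_ne_zero (u x)).hasDerivAt).comp_hasFDerivAt x hu'
  have hterm : ∀ i, fderiv ℝ (fun y => φ (u y) * ∑ j,
      (secondDeriv n u j j y * fderiv ℝ u y (stdVec n i)
        - secondDeriv n u i j y * fderiv ℝ u y (stdVec n j))) x (stdVec n i) =
      φ (u x) * ∑ j, (fderiv ℝ (secondDeriv n u j j) x (stdVec n i) * fderiv ℝ u x (stdVec n i)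
        + secondDeriv n u j j x * secondDeriv n u i i x
        - fderiv ℝ (secondDeriv n u i j) x (stdVec n i) * fderiv ℝ u x (stdVec n j)
        - secondDeriv n u i j x * secondDeriv n u i j x)
      + deriv φ (u x) * ∑ j, (secondDeriv n u j j x * fderiv ℝ u x (stdVec n i) ^ 2
        - secondDeriv n u i j x * fderiv ℝ u x (stdVec n i) * fderiv ℝ u x (stdVec n j)) := by
    intro i
    have h := hφ'.mul (HasFDerivAt.fun_sum (u := Finset.univ) fun j _ =>
      ((hH' j j).mul (hp' i)).sub ((hH' i j).mul (hp' j)))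
    refine (congrArg (fun L => L (stdVec n i)) h.fderiv).trans ?_
    simp only [add_apply, smul_apply, smul_eq_mul, sum_apply, sub_apply,
      Function.comp_apply, Pi.mul_apply, Pi.sub_apply]
    congr 1
    · refine congrArg _ (Finset.sum_congr rfl fun j _ => ?_)
      simp only [secondDeriv]
      ring
    · rw [mul_comm, mul_assoc, Finset.mul_sum]
      refine congrArg _ (Finset.sum_congr rfl fun j _ => ?_)
      ring
  have h3 : ∑ i, ∑ j, fderiv ℝ (secondDeriv n u i j) x (stdVec n i) * fderiv ℝ u x (stdVec n j) =
      ∑ i, ∑ j, fderiv ℝ (secondDeriv n u j j) x (stdVec n i) * fderiv ℝ u x (stdVec n i) := by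
    rw [Finset.sum_comm]
    exact Finset.sum_congr rfl fun i _ => Finset.sum_congr rfl fun j _ => by rw [hthird]
  have hlap : ∑ i, ∑ j, secondDeriv n u j j x * secondDeriv n u i i x = lap n u x ^ 2 := by
    rw [lap, sq, Finset.sum_mul_sum, Finset.sum_comm]
  have hsymm : ∑ i, ∑ j, secondDeriv n u i j x * secondDeriv n u i j x =
      ∑ i, ∑ j, secondDeriv n u i j x * secondDeriv n u j i x :=
    Finset.sum_congr rfl fun i _ => Finset.sum_congr rfl fun j _ => by
      rw [secondDeriv_comm hΩ hu2 hx j i]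
  have hgrad : ∑ i, ∑ j, secondDeriv n u j j x * fderiv ℝ u x (stdVec n i) ^ 2 =
      lap n u x * ‖gradient u x‖ ^ 2 := by
    simp only [EuclideanSpace.real_norm_sq_eq, gradient_apply_eq_fderiv, lap, Finset.sum_mul_sum]
    rw [Finset.sum_comm]
  rw [Finset.sum_congr rfl fun i _ => hterm i, Finset.sum_add_distrib, ← Finset.mul_sum,
    ← Finset.mul_sum]
  simp only [Finset.sum_add_distrib, Finset.sum_sub_distrib]
  rw [h3, hlap, hsymm, hgrad]
  simp only [gradient_apply_eq_fderiv]
  ring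
end

/-- **Integration by parts for the 2-Hessian.** If `Ω ⊆ ℝⁿ` is a bounded, open, connected set
with smooth boundary and `u ∈ C³(Ω) ∩ C¹(cl Ω)` vanishes on `∂Ω` (and the integrals below are
finite), then `2 ∫_Ω u S₂(D²u) = ∫_Ω (⟨D²u ∇u, ∇u⟩ - Δu ‖∇u‖²)`. -/
theorem hessian_S2_integration_by_parts (n : ℕ)
    (Ω : Set (EuclideanSpace ℝ (Fin n)))
    (hΩo : IsOpen Ω) (hΩconn : IsConnected Ω) (hΩb : Bornology.IsBounded Ω)
    (hΩbd : HasCkBoundary ⊤ Ω)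
    (u : EuclideanSpace ℝ (Fin n) → ℝ)
    (hu : ContDiffOn ℝ 3 u Ω) (hu1 : ContDiffOn ℝ 1 u (closure Ω))
    (hdir : ∀ x ∈ frontier Ω, u x = 0)
    (hint1 : IntegrableOn (fun x => u x *
        (((lap n u x) ^ 2 - ∑ i, ∑ j, secondDeriv n u i j x * secondDeriv n u j i x) / 2)) Ω)
    (hint2 : IntegrableOn (fun x =>
        (∑ i, ∑ j, secondDeriv n u i j x * gradient u x i * gradient u x j)
          - lap n u x * ‖gradient u x‖ ^ 2) Ω) :
    2 * (∫ x in Ω, u x *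
          (((lap n u x) ^ 2 - ∑ i, ∑ j, secondDeriv n u i j x * secondDeriv n u j i x) / 2))
      = ∫ x in Ω,
          ((∑ i, ∑ j, secondDeriv n u i j x * gradient u x i * gradient u x j)
            - lap n u x * ‖gradient u x‖ ^ 2) := by
  set D : EuclideanSpace ℝ (Fin n) → ℝ := fun x =>
    (lap n u x) ^ 2 - ∑ i, ∑ j, secondDeriv n u i j x * secondDeriv n u j i x with hD
  set B : EuclideanSpace ℝ (Fin n) → ℝ := fun x =>
    (∑ i, ∑ j, secondDeriv n u i j x * gradient u x i * gradient u x j)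
      - lap n u x * ‖gradient u x‖ ^ 2 with hB
  obtain ⟨φ, C, hφ, hφle, hφC, hφ0, hφlim⟩ := exists_contDiff_truncation
  have hDint : IntegrableOn (fun x => u x * D x) Ω := by
    refine IntegrableOn.congr_fun (hint1.const_mul 2) (fun x _ => ?_) hΩo.measurableSet
    simp only [hD]
    ring
  have htrunc : ∀ k, IntegrableOn (fun x => φ k (u x) * D x - deriv (φ k) (u x) * B x) Ω ∧
      ∫ x in Ω, (φ k (u x) * D x - deriv (φ k) (u x) * B x) = 0 := by
    intro k
    obtain ⟨ε, hε, hφε⟩ := hφ0 k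
    have hK : IsCompact (closure Ω ∩ {x | ε ≤ |u x|}) :=
      hΩb.isCompact_closure.of_isClosed_subset
        (hu1.continuousOn.abs.preimage_isClosed_of_isClosed isClosed_closure isClosed_Ici)
        inter_subset_left
    have hKΩ : closure Ω ∩ {x | ε ≤ |u x|} ⊆ Ω := by
      rintro x ⟨hxc, hx⟩
      by_contra hxΩ
      have := hdir x (by rw [hΩo.frontier_eq]; exact ⟨hxc, hxΩ⟩)
      simp only [mem_ofPred_eq, this, abs_zero] at hx
      exact hε.not_ge hx
    have hp : ∀ i, ContDiffOn ℝ 2 (fun x => fderiv ℝ u x (stdVec n i)) Ω :=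
      contDiffOn_fderiv_stdVec hΩo hu (by norm_num)
    have hH : ∀ i j, ContDiffOn ℝ 1 (secondDeriv n u i j) Ω := fun i j =>
      contDiffOn_fderiv_stdVec hΩo (hp j) (by norm_num) i
    have hdiv := fun i : Fin n => integrableOn_fderiv_and_setIntegral_eq_zero (μ := volume)
      (w := fun y => φ k (u y) * ∑ j, (secondDeriv n u j j y * fderiv ℝ u y (stdVec n i)
        - secondDeriv n u i j y * fderiv ℝ u y (stdVec n j))) hΩo hK hKΩ
      (((hφ k).comp_contDiffOn (hu.of_le (by norm_num))).mul (ContDiffOn.sum fun j _ =>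
        ((hH j j).mul ((hp i).of_le (by norm_num))).sub
          ((hH i j).mul ((hp j).of_le (by norm_num)))))
      (fun x hx hxK => by
        rw [hφε (u x) (not_le.1 fun h => hxK ⟨subset_closure hx, h⟩), zero_mul]) (stdVec n i)
    have heq : ∀ x ∈ Ω, ∑ i, fderiv ℝ (fun y => φ k (u y) * ∑ j,
        (secondDeriv n u j j y * fderiv ℝ u y (stdVec n i)
        - secondDeriv n u i j y * fderiv ℝ u y (stdVec n j))) x (stdVec n i) =
        φ k (u x) * D x - deriv (φ k) (u x) * B x := by
      intro x hx
      rw [sum_fderiv_comp_mul_hessianField hΩo hu (hφ k) hx]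
      simp only [hD, hB]
      ring
    refine ⟨IntegrableOn.congr_fun (integrable_finsetSum _ fun i _ => (hdiv i).1) heq
      hΩo.measurableSet, ?_⟩
    rw [← setIntegral_congr_fun hΩo.measurableSet heq, integral_finsetSum _ fun i _ => (hdiv i).1]
    exact Finset.sum_eq_zero fun i _ => (hdiv i).2
  have hae : ∀ᵐ x ∂volume.restrict Ω, u x = 0 → B x = 0 := by
    rw [ae_restrict_iff' hΩo.measurableSet]
    have hnull := measure_zero_set_fderiv_ne_zero (μ := volume) (f := u) (s := Ω)
      fun x hx => (hu.contDiffAt (hΩo.mem_nhds hx)).differentiableAt (by norm_num)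
    filter_upwards [measure_eq_zero_iff_ae_notMem.1 hnull] with x hx hxΩ hux
    have hgrad : gradient u x = 0 := by
      rw [gradient, not_not.1 fun h => hx ⟨hxΩ, hux, h⟩, map_zero]
    simp [hB, hgrad]
  have hlim : Filter.Tendsto (fun k => ∫ x in Ω, (φ k (u x) * D x - deriv (φ k) (u x) * B x))
      Filter.atTop (𝓝 (∫ x in Ω, (u x * D x - B x))) := by
    refine tendsto_integral_of_dominated_convergence (fun x => |u x * D x| + C * |B x|)
      (fun k => (htrunc k).1.aestronglyMeasurable) (hDint.abs.add (hint2.abs.const_mul C))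
      (fun k => Filter.Eventually.of_forall fun x => ?_) ?_
    · rw [Real.norm_eq_abs]
      refine (abs_sub _ _).trans ?_
      rw [abs_mul, abs_mul, abs_mul]
      exact add_le_add (mul_le_mul_of_nonneg_right (hφle k _) (abs_nonneg _))
        (mul_le_mul_of_nonneg_right (hφC k _) (abs_nonneg _))
    · filter_upwards [hae] with x hx
      refine tendsto_const_nhds.congr' ?_
      by_cases hux : u x = 0
      · refine Filter.Eventually.of_forall fun k => ?_
        have : φ k 0 = 0 := by simpa using hφle k 0
        simp [hux, hx hux, this]
      · filter_upwards [hφlim _ hux] with k hk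
        rw [hk.1, hk.2, one_mul]
  simp only [(htrunc _).2] at hlim
  have hzero := tendsto_nhds_unique hlim tendsto_const_nhds
  rw [integral_sub hDint hint2, sub_eq_zero] at hzero
  rw [← hzero, ← integral_const_mul]
  congr 1 with x
  ring
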